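/- arXiv:2003.03467 — 3 statements merged into one kernel-verified Lean document; each statement's English description precedes it below -/
import Mathlib

section
/- Let a20, a11, a10, a01, a00 and a20', a11', a10', a01', a00' and g be smooth real functions on ℝ², and define L u = ∂_x∂_x∂_y u + a20·∂_x∂_x u + a11·∂_x∂_y u + a10·∂_x u + a01·∂_y u + a00·u, and L' analogously with the primed coefficients. If L' u = e^{−g}·L(e^{g}·u) for every smooth u : ℝ² → ℝ, then the compatibility invariant agrees: 2·∂_x a20' − ∂_y a11' = 2·∂_x a20 − ∂_y a11. -/
noncomputable def dx (f : (Fin 2 → ℝ) → ℝ) : (Fin 2 → ℝ) → ℝ :=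
  fun p => fderiv ℝ f p (Pi.single 0 1)

noncomputable def dy (f : (Fin 2 → ℝ) → ℝ) : (Fin 2 → ℝ) → ℝ :=
  fun p => fderiv ℝ f p (Pi.single 1 1)

section DirectionalDerivatives

variable {f h : (Fin 2 → ℝ) → ℝ}

theorem ContDiff.dx (hf : ContDiff ℝ (⊤ : ℕ∞) f) : ContDiff ℝ (⊤ : ℕ∞) (dx f) :=
  (hf.fderiv_right (m := (⊤ : ℕ∞)) le_rfl).clm_apply contDiff_const

theorem ContDiff.dy (hf : ContDiff ℝ (⊤ : ℕ∞) f) : ContDiff ℝ (⊤ : ℕ∞) (dy f) :=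
  (hf.fderiv_right (m := (⊤ : ℕ∞)) le_rfl).clm_apply contDiff_const

theorem ContDiff.differentiableAt_of_smooth (hf : ContDiff ℝ (⊤ : ℕ∞) f) (p : Fin 2 → ℝ) :
    DifferentiableAt ℝ f p :=
  (hf.differentiable (by simp)) p

theorem dx_add (hf : ContDiff ℝ (⊤ : ℕ∞) f) (hh : ContDiff ℝ (⊤ : ℕ∞) h) :
    dx (fun p => f p + h p) = fun p => dx f p + dx h p := by
  funext p
  simp [dx, fderiv_fun_add (hf.differentiableAt_of_smooth p) (hh.differentiableAt_of_smooth p)]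

theorem dy_add (hf : ContDiff ℝ (⊤ : ℕ∞) f) (hh : ContDiff ℝ (⊤ : ℕ∞) h) :
    dy (fun p => f p + h p) = fun p => dy f p + dy h p := by
  funext p
  simp [dy, fderiv_fun_add (hf.differentiableAt_of_smooth p) (hh.differentiableAt_of_smooth p)]

theorem dx_mul (hf : ContDiff ℝ (⊤ : ℕ∞) f) (hh : ContDiff ℝ (⊤ : ℕ∞) h) :
    dx (fun p => f p * h p) = fun p => dx f p * h p + f p * dx h p := by
  funext p
  simp [dx, fderiv_fun_mul (hf.differentiableAt_of_smooth p) (hh.differentiableAt_of_smooth p)]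
  ring

theorem dy_mul (hf : ContDiff ℝ (⊤ : ℕ∞) f) (hh : ContDiff ℝ (⊤ : ℕ∞) h) :
    dy (fun p => f p * h p) = fun p => dy f p * h p + f p * dy h p := by
  funext p
  simp [dy, fderiv_fun_mul (hf.differentiableAt_of_smooth p) (hh.differentiableAt_of_smooth p)]
  ring

theorem dx_exp_mul (hf : ContDiff ℝ (⊤ : ℕ∞) f) (hh : ContDiff ℝ (⊤ : ℕ∞) h) :
    dx (fun p => Real.exp (f p) * h p) = fun p => Real.exp (f p) * (dx h p + dx f p * h p) := by
  rw [dx_mul hf.exp hh]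
  funext p
  simp [dx, fderiv_exp (hf.differentiableAt_of_smooth p)]
  ring

theorem dy_exp_mul (hf : ContDiff ℝ (⊤ : ℕ∞) f) (hh : ContDiff ℝ (⊤ : ℕ∞) h) :
    dy (fun p => Real.exp (f p) * h p) = fun p => Real.exp (f p) * (dy h p + dy f p * h p) := by
  rw [dy_mul hf.exp hh]
  funext p
  simp [dy, fderiv_exp (hf.differentiableAt_of_smooth p)]
  ring

theorem dx_dy_comm (hf : ContDiff ℝ (⊤ : ℕ∞) f) (p : Fin 2 → ℝ) :
    dx (dy f) p = dy (dx f) p := by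
  have hd : DifferentiableAt ℝ (fderiv ℝ f) p :=
    (hf.fderiv_right (m := (⊤ : ℕ∞)) le_rfl).differentiable (by simp) p
  have hsymm : IsSymmSndFDerivAt ℝ f p := hf.contDiffAt.isSymmSndFDerivAt (by
    simpa using WithTop.coe_le_coe.2 (le_top : (2 : ℕ∞) ≤ ⊤))
  have key (v w : Fin 2 → ℝ) :
      fderiv ℝ (fun q => fderiv ℝ f q v) p w = fderiv ℝ (fderiv ℝ f) p w v := by
    rw [fderiv_clm_apply hd (differentiableAt_const v)]
    simp
  exact (key _ _).trans ((hsymm.eq _ _).trans (key _ _).symm)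

theorem dx_const (c : ℝ) : dx (fun _ => c) = fun _ => 0 := by
  funext p
  simp [dx]

theorem dx_coord_sub (i : Fin 2) (c : ℝ) :
    dx (fun q => q i - c) = fun _ => if i = 0 then 1 else 0 := by
  funext p
  simp only [dx, fderiv_sub_const]
  rw [fderiv_apply differentiableAt_fun_id]
  simp [Pi.single_apply]

theorem dy_coord_sub (i : Fin 2) (c : ℝ) :
    dy (fun q => q i - c) = fun _ => if i = 1 then 1 else 0 := by
  funext p
  simp only [dy, fderiv_sub_const]
  rw [fderiv_apply differentiableAt_fun_id]
  simp [Pi.single_apply]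

end DirectionalDerivatives

/-- The gauge relation read off at a point where `u` vanishes to second order. -/
theorem gauge_second_order {a20 a11 a10 a01 a00 a20' a11' a10' a01' a00' : ℝ}
    {g u : (Fin 2 → ℝ) → ℝ} (hg : ContDiff ℝ (⊤ : ℕ∞) g) (hu : ContDiff ℝ (⊤ : ℕ∞) u)
    {x : Fin 2 → ℝ} (hu0 : u x = 0) (hux : dx u x = 0) (huy : dy u x = 0)
    (hgauge : dx (dx (dy u)) x + a20' * dx (dx u) x + a11' * dx (dy u) x
        + a10' * dx u x + a01' * dy u x + a00' * u x =
      Real.exp (-(g x)) *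
        (dx (dx (dy (fun y => Real.exp (g y) * u y))) x
          + a20 * dx (dx (fun y => Real.exp (g y) * u y)) x
          + a11 * dx (dy (fun y => Real.exp (g y) * u y)) x
          + a10 * dx (fun y => Real.exp (g y) * u y) x
          + a01 * dy (fun y => Real.exp (g y) * u y) x
          + a00 * (Real.exp (g x) * u x))) :
    a20' * dx (dx u) x + a11' * dx (dy u) x =
      (a20 + dy g x) * dx (dx u) x + (a11 + 2 * dx g x) * dx (dy u) x := by
  have hx1 : ContDiff ℝ (⊤ : ℕ∞) (fun p => dx u p + dx g p * u p) := hu.dx.add (hg.dx.mul hu)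
  have hy1 : ContDiff ℝ (⊤ : ℕ∞) (fun p => dy u p + dy g p * u p) := hu.dy.add (hg.dy.mul hu)
  have hxy : dx (fun p => dy u p + dy g p * u p) =
      fun p => dx (dy u) p + (dx (dy g) p * u p + dy g p * dx u p) := by
    rw [dx_add hu.dy (hg.dy.mul hu), dx_mul hg.dy hu]
  have hxx : dx (fun p => dx u p + dx g p * u p) =
      fun p => dx (dx u) p + (dx (dx g) p * u p + dx g p * dx u p) := by
    rw [dx_add hu.dx (hg.dx.mul hu), dx_mul hg.dx hu]
  have h1 : ContDiff ℝ (⊤ : ℕ∞) (fun p => dx (dy g) p * u p) := hg.dy.dx.mul hu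
  have h2 : ContDiff ℝ (⊤ : ℕ∞) (fun p => dy g p * dx u p) := hg.dy.mul hu.dx
  have h3 : ContDiff ℝ (⊤ : ℕ∞)
      (fun p => dx (dy u) p + (dx (dy g) p * u p + dy g p * dx u p)) :=
    hu.dy.dx.add (h1.add h2)
  have h4 : ContDiff ℝ (⊤ : ℕ∞) (fun p => dx g p * (dy u p + dy g p * u p)) := hg.dx.mul hy1
  rw [dy_exp_mul hg hu, dx_exp_mul hg hu, dx_exp_mul hg hy1, dx_exp_mul hg hx1, hxy, hxx,
    dx_exp_mul hg (h3.add h4), dx_add h3 h4, dx_add hu.dy.dx (h1.add h2), dx_add h1 h2,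
    dx_mul hg.dy.dx hu, dx_mul hg.dy hu.dx, dx_mul hg.dx hy1, hxy] at hgauge
  simp only [hu0, hux, huy, mul_zero, add_zero, zero_add] at hgauge
  have he : Real.exp (-(g x)) * Real.exp (g x) = 1 := by rw [← Real.exp_add]; simp
  linear_combination hgauge + (dx (dx (dy u)) x + (a20 + dy g x) * dx (dx u) x
    + (a11 + 2 * dx g x) * dx (dy u) x) * he

theorem compatibility_invariant_xxy
    (a20 a11 a10 a01 a00 a20' a11' a10' a01' a00' g : (Fin 2 → ℝ) → ℝ)
    (h20 : ContDiff ℝ (⊤ : ℕ∞) a20) (h11 : ContDiff ℝ (⊤ : ℕ∞) a11) (h10 : ContDiff ℝ (⊤ : ℕ∞) a10)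
    (h01 : ContDiff ℝ (⊤ : ℕ∞) a01) (h00 : ContDiff ℝ (⊤ : ℕ∞) a00)
    (h20' : ContDiff ℝ (⊤ : ℕ∞) a20') (h11' : ContDiff ℝ (⊤ : ℕ∞) a11') (h10' : ContDiff ℝ (⊤ : ℕ∞) a10')
    (h01' : ContDiff ℝ (⊤ : ℕ∞) a01') (h00' : ContDiff ℝ (⊤ : ℕ∞) a00')
    (hg : ContDiff ℝ (⊤ : ℕ∞) g)
    (hgauge : ∀ u : (Fin 2 → ℝ) → ℝ, ContDiff ℝ (⊤ : ℕ∞) u → ∀ x,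
      dx (dx (dy u)) x + a20' x * dx (dx u) x + a11' x * dx (dy u) x
        + a10' x * dx u x + a01' x * dy u x + a00' x * u x =
      Real.exp (-(g x)) *
        (dx (dx (dy (fun y => Real.exp (g y) * u y))) x
          + a20 x * dx (dx (fun y => Real.exp (g y) * u y)) x
          + a11 x * dx (dy (fun y => Real.exp (g y) * u y)) x
          + a10 x * dx (fun y => Real.exp (g y) * u y) x
          + a01 x * dy (fun y => Real.exp (g y) * u y) x
          + a00 x * (Real.exp (g x) * u x))) :
    ∀ x, 2 * dx a20' x - dy a11' x = 2 * dx a20 x - dy a11 x := by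
  have hX (p : Fin 2 → ℝ) (i : Fin 2) : ContDiff ℝ (⊤ : ℕ∞) (fun q : Fin 2 → ℝ => q i - p i) :=
    (contDiff_apply ℝ ℝ i).sub contDiff_const
  have e20 : a20' = fun p => a20 p + dy g p := by
    funext p
    have hu : ContDiff ℝ (⊤ : ℕ∞) (fun q : Fin 2 → ℝ => (q 0 - p 0) * (q 0 - p 0)) :=
      (hX p 0).mul (hX p 0)
    have hux := dx_mul (hX p 0) (hX p 0)
    have huy := dy_mul (hX p 0) (hX p 0)
    simp only [dx_coord_sub, dy_coord_sub, if_true, zero_ne_one, if_false, one_mul, mul_one,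
      zero_mul, mul_zero, add_zero] at hux huy
    have key := gauge_second_order hg hu (by simp) (by simp [hux]) (by simp [huy])
      (hgauge _ hu p)
    rw [hux, huy, dx_add (hX p 0) (hX p 0), dx_const] at key
    simp only [dx_coord_sub, if_true] at key
    linarith
  have e11 : a11' = fun p => a11 p + 2 * dx g p := by
    funext p
    have hu : ContDiff ℝ (⊤ : ℕ∞) (fun q : Fin 2 → ℝ => (q 0 - p 0) * (q 1 - p 1)) :=
      (hX p 0).mul (hX p 1)
    have hux := dx_mul (hX p 0) (hX p 1)
    have huy := dy_mul (hX p 0) (hX p 1)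
    simp only [dx_coord_sub, dy_coord_sub, if_true, zero_ne_one, one_ne_zero, if_false, one_mul,
      mul_one, zero_mul, mul_zero, add_zero, zero_add] at hux huy
    have key := gauge_second_order hg hu (by simp) (by simp [hux]) (by simp [huy])
      (hgauge _ hu p)
    rw [hux, huy] at key
    simp only [dx_coord_sub, if_true, one_ne_zero, if_false] at key
    linarith
  intro x
  have hdx : dx a20' x = dx a20 x + dx (dy g) x := by rw [e20, dx_add h20 hg.dy]
  have hdy : dy a11' x = dy a11 x + 2 * dy (dx g) x := by
    have h2 : ContDiff ℝ (⊤ : ℕ∞) (fun p => dx g p + dx g p) := hg.dx.add hg.dx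
    simp only [two_mul] at e11
    rw [e11, dy_add h11 h2, dy_add hg.dx hg.dx]
    ring
  rw [hdx, hdy, dx_dy_comm hg x]
  ring
end

section
/- Let a20, a11, a02, a10, a01, a00 and a20', a11', a02', a10', a01', a00' and g be smooth real functions on ℝ², with a02(x) ≠ 0 for all x ∈ ℝ². Define L u = ∂_x∂_x∂_x u + a20·∂_x∂_x u + a11·∂_x∂_y u + a02·∂_y∂_y u + a10·∂_x u + a01·∂_y u + a00·u, and L' analogously with the primed coefficients. If L' u = e^{−g}·L(e^{g}·u) for every smooth u : ℝ² → ℝ, then the compatibility invariant agrees: 2·∂_y a20' − 3·∂_x(a01'/a02') + ∂_x(a11'·a20'/a02') = 2·∂_y a20 − 3·∂_x(a01/a02) + ∂_x(a11·a20/a02). -/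
/-- The partial derivative in the `i`-th coordinate. -/
noncomputable def partialDeriv (i : Fin 2) (f : (Fin 2 → ℝ) → ℝ) : (Fin 2 → ℝ) → ℝ :=
  fun p => fderiv ℝ f p (Pi.single i 1)

section PartialDeriv

variable {f h g u : (Fin 2 → ℝ) → ℝ}

theorem dx_eq_partialDeriv : dx = partialDeriv 0 := rfl

theorem dy_eq_partialDeriv : dy = partialDeriv 1 := rfl

theorem ContDiff.partialDeriv (hf : ContDiff ℝ (⊤ : ℕ∞) f) (i : Fin 2) :
    ContDiff ℝ (⊤ : ℕ∞) (partialDeriv i f) :=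
  (hf.fderiv_right (m := (⊤ : ℕ∞)) (by simp)).clm_apply contDiff_const

theorem ContDiff.differentiable_of_smooth (hf : ContDiff ℝ (⊤ : ℕ∞) f) : Differentiable ℝ f :=
  hf.differentiable (by simp)

theorem partialDeriv_add (hf : Differentiable ℝ f) (hh : Differentiable ℝ h) (i : Fin 2) :
    partialDeriv i (fun y => f y + h y) = fun y => partialDeriv i f y + partialDeriv i h y := by
  funext p
  simp [partialDeriv, fderiv_fun_add (hf p) (hh p)]

theorem partialDeriv_mul (hf : Differentiable ℝ f) (hh : Differentiable ℝ h) (i : Fin 2) :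
    partialDeriv i (fun y => f y * h y) =
      fun y => partialDeriv i f y * h y + f y * partialDeriv i h y := by
  funext p
  simp [partialDeriv, fderiv_fun_mul (hf p) (hh p)]
  ring

theorem partialDeriv_const (c : ℝ) (i : Fin 2) : partialDeriv i (fun _ => c) = fun _ => 0 := by
  funext p
  simp [partialDeriv]

theorem partialDeriv_coord_sub (c : ℝ) (i j : Fin 2) :
    partialDeriv i (fun y => y j - c) = fun _ => (Pi.single i 1 : Fin 2 → ℝ) j := by
  funext p
  have : HasFDerivAt (fun y : Fin 2 → ℝ => y j - c) (ContinuousLinearMap.proj (R := ℝ) j) p :=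
    (ContinuousLinearMap.proj (R := ℝ) (φ := fun _ : Fin 2 => ℝ) j).hasFDerivAt.sub_const c
  simp [partialDeriv, this.fderiv]

theorem partialDeriv_comm (hf : ContDiff ℝ (⊤ : ℕ∞) f) (i j : Fin 2) (p : Fin 2 → ℝ) :
    partialDeriv i (partialDeriv j f) p = partialDeriv j (partialDeriv i f) p := by
  have hd : DifferentiableAt ℝ (fderiv ℝ f) p :=
    (hf.fderiv_right (m := (⊤ : ℕ∞)) (by simp)).differentiable (by simp) p
  have key (k l : Fin 2) : partialDeriv k (partialDeriv l f) p =
      fderiv ℝ (fderiv ℝ f) p (Pi.single k 1) (Pi.single l 1) := by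
    unfold partialDeriv
    rw [fderiv_clm_apply hd (differentiableAt_const _)]
    simp
  rw [key, key]
  exact hf.contDiffAt.isSymmSndFDerivAt (by simpa using ENat.LEInfty.out) _ _

theorem partialDeriv_exp_mul (hg : Differentiable ℝ g) (hu : Differentiable ℝ u) (i : Fin 2) :
    partialDeriv i (fun y => Real.exp (g y) * u y) =
      fun y => Real.exp (g y) * (partialDeriv i u y + partialDeriv i g y * u y) := by
  rw [partialDeriv_mul hg.exp hu]
  funext p
  simp only [partialDeriv, fderiv_exp (hg p), smul_eq_mul, smul_apply]
  ring

theorem partialDeriv_partialDeriv_exp_mul (hg : ContDiff ℝ (⊤ : ℕ∞) g)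
    (hu : ContDiff ℝ (⊤ : ℕ∞) u) (i j : Fin 2) :
    partialDeriv i (partialDeriv j (fun y => Real.exp (g y) * u y)) =
      fun y => Real.exp (g y) * (partialDeriv i (partialDeriv j u) y
        + partialDeriv i g y * partialDeriv j u y + partialDeriv j g y * partialDeriv i u y
        + (partialDeriv i (partialDeriv j g) y + partialDeriv i g y * partialDeriv j g y)
          * u y) := by
  have hgj := hg.partialDeriv j
  have huj := hu.partialDeriv j
  rw [partialDeriv_exp_mul hg.differentiable_of_smooth hu.differentiable_of_smooth,
    partialDeriv_exp_mul hg.differentiable_of_smooth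
      (huj.add (hgj.mul hu)).differentiable_of_smooth,
    partialDeriv_add huj.differentiable_of_smooth (hgj.mul hu).differentiable_of_smooth,
    partialDeriv_mul hgj.differentiable_of_smooth hu.differentiable_of_smooth]
  funext p
  ring

theorem exists_partialDeriv_iterate_three_exp_mul (hg : ContDiff ℝ (⊤ : ℕ∞) g) (i : Fin 2) :
    ∃ c d : (Fin 2 → ℝ) → ℝ, ∀ u : (Fin 2 → ℝ) → ℝ, ContDiff ℝ (⊤ : ℕ∞) u →
      partialDeriv i (partialDeriv i (partialDeriv i (fun y => Real.exp (g y) * u y))) =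
        fun y => Real.exp (g y) * (partialDeriv i (partialDeriv i (partialDeriv i u)) y
          + 3 * partialDeriv i g y * partialDeriv i (partialDeriv i u) y
          + c y * partialDeriv i u y + d y * u y) := by
  have hgi := hg.partialDeriv i
  have hgii := hgi.partialDeriv i
  refine ⟨fun y => 3 * (partialDeriv i (partialDeriv i g) y + partialDeriv i g y ^ 2),
    fun y => partialDeriv i (partialDeriv i (partialDeriv i g)) y
      + 3 * partialDeriv i g y * partialDeriv i (partialDeriv i g) y + partialDeriv i g y ^ 3,
    fun u hu => ?_⟩
  have hui := hu.partialDeriv i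
  rw [partialDeriv_exp_mul hg.differentiable_of_smooth hu.differentiable_of_smooth,
    partialDeriv_partialDeriv_exp_mul hg (hui.add (hgi.mul hu)),
    partialDeriv_add hui.differentiable_of_smooth (hgi.mul hu).differentiable_of_smooth,
    partialDeriv_mul hgi.differentiable_of_smooth hu.differentiable_of_smooth,
    partialDeriv_add (hui.partialDeriv i).differentiable_of_smooth
      ((hgii.mul hu).add (hgi.mul hui)).differentiable_of_smooth,
    partialDeriv_add (hgii.mul hu).differentiable_of_smooth
      (hgi.mul hui).differentiable_of_smooth,
    partialDeriv_mul hgii.differentiable_of_smooth hu.differentiable_of_smooth,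
    partialDeriv_mul hgi.differentiable_of_smooth hui.differentiable_of_smooth]
  funext p
  ring

theorem contDiff_coord_sub (c : ℝ) (j : Fin 2) :
    ContDiff ℝ (⊤ : ℕ∞) (fun y : Fin 2 → ℝ => y j - c) :=
  (contDiff_apply ℝ ℝ j).sub contDiff_const

theorem partialDeriv_coord_sub_mul (a b : ℝ) (i j k : Fin 2) :
    partialDeriv i (fun y => (y j - a) * (y k - b)) =
      fun y => (Pi.single i 1 : Fin 2 → ℝ) j * (y k - b)
        + (y j - a) * (Pi.single i 1 : Fin 2 → ℝ) k := by
  rw [partialDeriv_mul (contDiff_coord_sub a j).differentiable_of_smooth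
    (contDiff_coord_sub b k).differentiable_of_smooth]
  simp only [partialDeriv_coord_sub]

theorem partialDeriv_partialDeriv_coord_sub_mul (a b : ℝ) (i l j k : Fin 2) :
    partialDeriv l (partialDeriv i (fun y => (y j - a) * (y k - b))) =
      fun _ => (Pi.single i 1 : Fin 2 → ℝ) j * (Pi.single l 1 : Fin 2 → ℝ) k
        + (Pi.single l 1 : Fin 2 → ℝ) j * (Pi.single i 1 : Fin 2 → ℝ) k := by
  have hj := contDiff_coord_sub a j
  have hk := contDiff_coord_sub b k
  rw [partialDeriv_coord_sub_mul,
    partialDeriv_add (contDiff_const.mul hk).differentiable_of_smooth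
      (hj.mul contDiff_const).differentiable_of_smooth,
    partialDeriv_mul (differentiable_const _) hk.differentiable_of_smooth,
    partialDeriv_mul hj.differentiable_of_smooth (differentiable_const _)]
  simp [partialDeriv_coord_sub, partialDeriv_const]

end PartialDeriv

theorem compatibility_invariant_xxx
    (a20 a11 a02 a10 a01 a00 a20' a11' a02' a10' a01' a00' g : (Fin 2 → ℝ) → ℝ)
    (h20 : ContDiff ℝ (⊤ : ℕ∞) a20) (h11 : ContDiff ℝ (⊤ : ℕ∞) a11) (h02 : ContDiff ℝ (⊤ : ℕ∞) a02)
    (h10 : ContDiff ℝ (⊤ : ℕ∞) a10) (h01 : ContDiff ℝ (⊤ : ℕ∞) a01) (h00 : ContDiff ℝ (⊤ : ℕ∞) a00)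
    (h20' : ContDiff ℝ (⊤ : ℕ∞) a20') (h11' : ContDiff ℝ (⊤ : ℕ∞) a11') (h02' : ContDiff ℝ (⊤ : ℕ∞) a02')
    (h10' : ContDiff ℝ (⊤ : ℕ∞) a10') (h01' : ContDiff ℝ (⊤ : ℕ∞) a01') (h00' : ContDiff ℝ (⊤ : ℕ∞) a00')
    (hg : ContDiff ℝ (⊤ : ℕ∞) g)
    (hgauge : ∀ u : (Fin 2 → ℝ) → ℝ, ContDiff ℝ (⊤ : ℕ∞) u → ∀ x,
      dx (dx (dx u)) x + a20' x * dx (dx u) x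
        + a11' x * dx (dy u) x + a02' x * dy (dy u) x
        + a10' x * dx u x + a01' x * dy u x + a00' x * u x =
      Real.exp (-(g x)) *
        (dx (dx (dx (fun y => Real.exp (g y) * u y))) x
          + a20 x * dx (dx (fun y => Real.exp (g y) * u y)) x
          + a11 x * dx (dy (fun y => Real.exp (g y) * u y)) x
          + a02 x * dy (dy (fun y => Real.exp (g y) * u y)) x
          + a10 x * dx (fun y => Real.exp (g y) * u y) x
          + a01 x * dy (fun y => Real.exp (g y) * u y) x
          + a00 x * (Real.exp (g x) * u x)))
    (ha02ne : ∀ x, a02 x ≠ 0) :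
    ∀ x, 2 * dy a20' x - 3 * dx (fun y => a01' y / a02' y) x
          + dx (fun y => a11' y * a20' y / a02' y) x =
         2 * dy a20 x - 3 * dx (fun y => a01 y / a02 y) x
          + dx (fun y => a11 y * a20 y / a02 y) x := by
  rw [dx_eq_partialDeriv, dy_eq_partialDeriv] at *
  obtain ⟨c, d, hcube⟩ := exists_partialDeriv_iterate_three_exp_mul hg 0
  have hL (u : (Fin 2 → ℝ) → ℝ) (hu : ContDiff ℝ (⊤ : ℕ∞) u) (x : Fin 2 → ℝ) := by
    have h := hgauge u hu x
    rw [hcube u hu, partialDeriv_partialDeriv_exp_mul hg hu,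
      partialDeriv_partialDeriv_exp_mul hg hu, partialDeriv_partialDeriv_exp_mul hg hu,
      partialDeriv_exp_mul hg.differentiable_of_smooth hu.differentiable_of_smooth,
      partialDeriv_exp_mul hg.differentiable_of_smooth hu.differentiable_of_smooth] at h
    have hexp (A B C D E F G : ℝ) : Real.exp (-(g x)) *
        (Real.exp (g x) * A + a20 x * (Real.exp (g x) * B) + a11 x * (Real.exp (g x) * C)
          + a02 x * (Real.exp (g x) * D) + a10 x * (Real.exp (g x) * E)
          + a01 x * (Real.exp (g x) * F) + a00 x * (Real.exp (g x) * G)) =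
        A + a20 x * B + a11 x * C + a02 x * D + a10 x * E + a01 x * F + a00 x * G := by
      have he : Real.exp (-(g x)) * Real.exp (g x) = 1 := by simp [← Real.exp_add]
      linear_combination (A + a20 x * B + a11 x * C + a02 x * D + a10 x * E + a01 x * F
        + a00 x * G) * he
    exact h.trans (hexp _ _ _ _ _ _ _)
  have hquad (j k : Fin 2) (x : Fin 2 → ℝ) := hL _
    ((contDiff_coord_sub (x j) j).mul (contDiff_coord_sub (x k) k)) x
  simp only [partialDeriv_partialDeriv_coord_sub_mul] at hquad
  simp only [partialDeriv_coord_sub_mul, partialDeriv_const, sub_self] at hquad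
  have e20 (x) : a20' x = a20 x + 3 * partialDeriv 0 g x := by
    have := hquad 0 0 x
    simp at this
    linarith
  have e11 (x) : a11' x = a11 x := by
    have := hquad 0 1 x
    simp at this
    linarith
  have e02 (x) : a02' x = a02 x := by
    have := hquad 1 1 x
    simp at this
    linarith
  have e01 (x) : a01' x = a01 x + a11 x * partialDeriv 0 g x + 2 * a02 x * partialDeriv 1 g x := by
    have := hL _ (contDiff_coord_sub (x 1) 1) x
    simp [partialDeriv_coord_sub, partialDeriv_const] at this
    linarith
  intro x
  have hg0 := hg.partialDeriv 0
  have hg1 := hg.partialDeriv 1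
  have hP : ContDiff ℝ (⊤ : ℕ∞) (fun y => a01 y / a02 y) :=
    h01.div h02 ha02ne
  have hQ : ContDiff ℝ (⊤ : ℕ∞) (fun y => a11 y * a20 y / a02 y) :=
    (h11.mul h20).div h02 ha02ne
  have hR : ContDiff ℝ (⊤ : ℕ∞) (fun y => a11 y * partialDeriv 0 g y / a02 y) :=
    (h11.mul hg0).div h02 ha02ne
  have f20 : a20' = fun y => a20 y + 3 * partialDeriv 0 g y := funext e20
  have f01 : (fun y => a01' y / a02' y) = fun y => a01 y / a02 y
      + (a11 y * partialDeriv 0 g y / a02 y + 2 * partialDeriv 1 g y) := by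
    funext y
    have := ha02ne y
    rw [e01, e02]
    field_simp
    ring
  have f11 : (fun y => a11' y * a20' y / a02' y) = fun y => a11 y * a20 y / a02 y
      + 3 * (a11 y * partialDeriv 0 g y / a02 y) := by
    funext y
    rw [e11, e20, e02]
    ring
  rw [f01, f11, f20,
    partialDeriv_add h20.differentiable_of_smooth
      (contDiff_const.mul hg0).differentiable_of_smooth,
    partialDeriv_add hP.differentiable_of_smooth
      (hR.add (contDiff_const.mul hg1)).differentiable_of_smooth,
    partialDeriv_add hR.differentiable_of_smooth
      (contDiff_const.mul hg1).differentiable_of_smooth,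
    partialDeriv_add hQ.differentiable_of_smooth
      (contDiff_const.mul hR).differentiable_of_smooth,
    partialDeriv_mul (differentiable_const _) hg0.differentiable_of_smooth,
    partialDeriv_mul (differentiable_const _) hg1.differentiable_of_smooth,
    partialDeriv_mul (differentiable_const _) hR.differentiable_of_smooth]
  simp only [partialDeriv_const]
  linear_combination 6 * partialDeriv_comm hg 1 0 x
end

section
/- Let a31, a22, a30 and a31', a22', a30' and g be smooth real functions on ℝ², and suppose they satisfy the gauge transformation laws of the class maximally generated by {∂_x³∂_y²}: a31' = a31 + 2·∂_y g, a22' = a22 + 3·∂_x g, and a30' = a30 + a31·∂_y g + (∂_y g)² + ∂_y∂_y g. Then: (i) the compatibility invariant agrees, 2·∂_y a22' − 3·∂_x a31' = 2·∂_y a22 − 3·∂_x a31; and (ii) the upward invariant agrees, a30' − ((a31')²/4 + (∂_y a31')/2) = a30 − (a31²/4 + (∂_y a31)/2). -/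
theorem dx_add_const_mul {f h : (Fin 2 → ℝ) → ℝ} (hf : Differentiable ℝ f)
    (hh : Differentiable ℝ h) (c : ℝ) (x : Fin 2 → ℝ) :
    dx (fun y => f y + c * h y) x = dx f x + c * dx h x := by
  simp [dx, fderiv_fun_add (hf x) ((hh x).const_mul c), fderiv_const_mul (hh x)]

theorem dy_add_const_mul {f h : (Fin 2 → ℝ) → ℝ} (hf : Differentiable ℝ f)
    (hh : Differentiable ℝ h) (c : ℝ) (x : Fin 2 → ℝ) :
    dy (fun y => f y + c * h y) x = dy f x + c * dy h x := by
  simp [dy, fderiv_fun_add (hf x) ((hh x).const_mul c), fderiv_const_mul (hh x)]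

theorem differentiable_fderiv_of_contDiff_two {f : (Fin 2 → ℝ) → ℝ} (hf : ContDiff ℝ 2 f) :
    Differentiable ℝ (fderiv ℝ f) :=
  (hf.fderiv_right (m := 1) (by norm_num)).differentiable (by norm_num)

theorem differentiable_dx {f : (Fin 2 → ℝ) → ℝ} (hf : ContDiff ℝ 2 f) :
    Differentiable ℝ (dx f) :=
  (differentiable_fderiv_of_contDiff_two hf).clm_apply (differentiable_const _)

theorem differentiable_dy {f : (Fin 2 → ℝ) → ℝ} (hf : ContDiff ℝ 2 f) :
    Differentiable ℝ (dy f) :=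
  (differentiable_fderiv_of_contDiff_two hf).clm_apply (differentiable_const _)

theorem dy_dx_eq_dx_dy {f : (Fin 2 → ℝ) → ℝ} (hf : ContDiff ℝ 2 f) (x : Fin 2 → ℝ) :
    dy (dx f) x = dx (dy f) x := by
  have hd := differentiable_fderiv_of_contDiff_two hf x
  have hs : IsSymmSndFDerivAt ℝ f x :=
    hf.contDiffAt.isSymmSndFDerivAt (by simp [minSmoothness_of_isRCLikeNormedField])
  unfold dx dy
  rw [fderiv_clm_apply hd (differentiableAt_const _),
    fderiv_clm_apply hd (differentiableAt_const _)]
  simpa using hs.eq (Pi.single 1 1) (Pi.single 0 1)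

theorem invariants_xxxyy
    (a31 a22 a30 a31' a22' a30' g : (Fin 2 → ℝ) → ℝ)
    (h31 : ContDiff ℝ (⊤ : ℕ∞) a31) (h22 : ContDiff ℝ (⊤ : ℕ∞) a22) (h30 : ContDiff ℝ (⊤ : ℕ∞) a30)
    (h31' : ContDiff ℝ (⊤ : ℕ∞) a31') (h22' : ContDiff ℝ (⊤ : ℕ∞) a22') (h30' : ContDiff ℝ (⊤ : ℕ∞) a30')
    (hg : ContDiff ℝ (⊤ : ℕ∞) g)
    (hl31 : ∀ x, a31' x = a31 x + 2 * dy g x)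
    (hl22 : ∀ x, a22' x = a22 x + 3 * dx g x)
    (hl30 : ∀ x, a30' x = a30 x + a31 x * dy g x + (dy g x) ^ 2 + dy (dy g) x) :
    (∀ x, 2 * dy a22' x - 3 * dx a31' x = 2 * dy a22 x - 3 * dx a31 x) ∧
    (∀ x, a30' x - ((a31' x) ^ 2 / 4 + dy a31' x / 2) =
          a30 x - ((a31 x) ^ 2 / 4 + dy a31 x / 2)) := by
  have hg2 : ContDiff ℝ 2 g := contDiff_infty.mp hg 2
  have d31 : Differentiable ℝ a31 := h31.differentiable (by simp)
  have d22 : Differentiable ℝ a22 := h22.differentiable (by simp)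
  obtain rfl : a31' = fun x => a31 x + 2 * dy g x := funext hl31
  obtain rfl : a22' = fun x => a22 x + 3 * dx g x := funext hl22
  refine ⟨fun x => ?_, fun x => ?_⟩
  · rw [dy_add_const_mul d22 (differentiable_dx hg2),
      dx_add_const_mul d31 (differentiable_dy hg2), dy_dx_eq_dx_dy hg2]
    ring
  · rw [dy_add_const_mul d31 (differentiable_dy hg2), hl30]
    ring
end
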